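/- arXiv:math/0612730 — 2 statements merged into one kernel-verified Lean document; each statement's English description precedes it below -/
import Mathlib

section
/- The monic Askey–Wilson polynomial P_n satisfies the eigenvalue equation D_sym P_n = (q^{-n} + abcd·q^{n-1}) P_n. -/
open scoped BigOperators

noncomputable section

/-- The field of rational functions over ℂ, in which Laurent polynomials live. -/
local notation "F" => RatFunc ℂ

/-- Scalar constants in `F`. -/
def Cc (x : ℂ) : F := RatFunc.C x

/-- The variable `z`. -/
def Xv : F := RatFunc.X

/-- Substitution `z ↦ t` in a rational function (well defined since the
substitution points used here are transcendental over ℂ). -/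
def subst (t : F) (f : F) : F := RatFunc.eval (RatFunc.C) t f

/-- `f` is a Laurent polynomial in `z`. -/
def IsLaurent (f : F) : Prop :=
  ∃ (p : Polynomial ℂ) (n : ℕ), f = algebraMap (Polynomial ℂ) F p / Xv ^ n

/-- The DAHA operator `T₁` of the basic representation. -/
def T1op (a b : ℂ) (f : F) : F :=
  ((Cc a + Cc b) * Xv - (1 + Cc a * Cc b)) / (1 - Xv ^ 2) * f
    + ((1 - Cc a * Xv) * (1 - Cc b * Xv)) / (1 - Xv ^ 2) * subst Xv⁻¹ f

/-- The DAHA operator `T₀` of the basic representation. -/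
def T0op (q c d : ℂ) (f : F) : F :=
  (Cc q)⁻¹ * Xv * ((Cc c * Cc d + Cc q) * Xv - (Cc c + Cc d) * Cc q) / (Cc q - Xv ^ 2) * f
    - ((Cc c - Xv) * (Cc d - Xv)) / (Cc q - Xv ^ 2) * subst (Cc q * Xv⁻¹) f

/-- The inverse of `T₁`: `T₁⁻¹ = -(ab)⁻¹T₁ - (1 + (ab)⁻¹)`. -/
def T1inv (a b : ℂ) (f : F) : F :=
  -(Cc a * Cc b)⁻¹ * T1op a b f - (1 + (Cc a * Cc b)⁻¹) * f

/-- The inverse of `T₀`: `T₀⁻¹ = -q(cd)⁻¹T₀ - (1 + q(cd)⁻¹)`. -/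
def T0inv (q c d : ℂ) (f : F) : F :=
  -(Cc q * (Cc c * Cc d)⁻¹) * T0op q c d f - (1 + Cc q * (Cc c * Cc d)⁻¹) * f

/-- `Y = T₁T₀`. -/
def Yop (q a b c d : ℂ) (f : F) : F := T1op a b (T0op q c d f)

/-- `Y⁻¹ = T₀⁻¹T₁⁻¹`. -/
def Yinv (q a b c d : ℂ) (f : F) : F := T0inv q c d (T1inv a b f)

/-- `D = Y + q⁻¹abcd·Y⁻¹`. -/
def Dop (q a b c d : ℂ) (f : F) : F :=
  Yop q a b c d f + Cc (q⁻¹ * (a * b * c * d)) * Yinv q a b c d f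

/-- The Askey–Wilson second order q-difference operator `D_sym`. -/
def DsymOp (q a b c d : ℂ) (f : F) : F :=
  ((1 - Cc a * Xv) * (1 - Cc b * Xv) * (1 - Cc c * Xv) * (1 - Cc d * Xv)) /
      ((1 - Xv ^ 2) * (1 - Cc q * Xv ^ 2)) * (subst (Cc q * Xv) f - f)
    + ((Cc a - Xv) * (Cc b - Xv) * (Cc c - Xv) * (Cc d - Xv)) /
      ((1 - Xv ^ 2) * (Cc q - Xv ^ 2)) * (subst ((Cc q)⁻¹ * Xv) f - f)
    + (1 + (Cc q)⁻¹ * Cc a * Cc b * Cc c * Cc d) * f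

/-- q-Pochhammer symbol `(x;q)_k`. -/
def qPoch (x q : ℂ) (k : ℕ) : ℂ := ∏ j ∈ Finset.range k, (1 - x * q ^ j)

/-- The monic Askey–Wilson Laurent polynomial `P_n[z;a,b,c,d|q]`. -/
def AWP (q a b c d : ℂ) (n : ℕ) : F :=
  Cc (a⁻¹ ^ n) * ∑ k ∈ Finset.range (n + 1),
    Cc (qPoch (q⁻¹ ^ n) q k * qPoch (a * b * q ^ k) q (n - k) * qPoch (a * c * q ^ k) q (n - k)
        * qPoch (a * d * q ^ k) q (n - k) * q ^ k
        / (qPoch q q k * qPoch (a * b * c * d * q ^ (n + k) / q) q (n - k)))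
      * (∏ j ∈ Finset.range k, (1 - Cc a * Xv * Cc (q ^ j)))
      * (∏ j ∈ Finset.range k, (1 - Cc a * Xv⁻¹ * Cc (q ^ j)))

/-- `Q_n[z] := (ab)⁻¹ z⁻¹ (1-az)(1-bz) P_{n-1}[z;qa,qb,c,d|q]`. -/
def Qpoly (q a b c d : ℂ) (n : ℕ) : F :=
  (Cc (a * b))⁻¹ * Xv⁻¹ * (1 - Cc a * Xv) * (1 - Cc b * Xv) *
    AWP q (q * a) (q * b) c d (n - 1)

/-- Elementary symmetric polynomials in a,b,c,d. -/
def esym1 (a b c d : ℂ) : ℂ := a + b + c + d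
def esym2 (a b c d : ℂ) : ℂ := a*b + a*c + b*c + a*d + b*d + c*d
def esym3 (a b c d : ℂ) : ℂ := a*b*c + a*b*d + a*c*d + b*c*d
def esym4 (a b c d : ℂ) : ℂ := a*b*c*d


/-- Substitution `z ↦ r z` never kills a denominator. -/
lemma eval2_ne_zero (r : ℂ) (hr : r ≠ 0) (p : Polynomial ℂ) (hp : p ≠ 0) :
    Polynomial.eval₂ (RatFunc.C) (Cc r * Xv) p ≠ 0 := by
  have h : Polynomial.eval₂ (RatFunc.C) (Cc r * Xv) p
      = algebraMap (Polynomial ℂ) (RatFunc ℂ) (p.comp (Polynomial.C r * Polynomial.X)) := by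
    rw [Polynomial.comp, Polynomial.hom_eval₂]
    congr 1
    simp [Cc, Xv]
  rw [h]
  intro h0
  have h1 := (map_eq_zero_iff _ (RatFunc.algebraMap_injective ℂ)).1 h0
  exact hp ((Polynomial.comp_C_mul_X_eq_zero_iff (by simpa using hr)).1 h1)

/-- The substitution `z ↦ r z` as a ring homomorphism. -/
def sigmaHom (r : ℂ) (hr : r ≠ 0) : RatFunc ℂ →+* RatFunc ℂ where
  toFun := subst (Cc r * Xv)
  map_one' := RatFunc.eval_one _ _
  map_zero' := RatFunc.eval_zero _ _
  map_mul' x y := RatFunc.eval_mul _ _ (eval2_ne_zero r hr _ (RatFunc.denom_ne_zero x))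
    (eval2_ne_zero r hr _ (RatFunc.denom_ne_zero y))
  map_add' x y := RatFunc.eval_add _ _ (eval2_ne_zero r hr _ (RatFunc.denom_ne_zero x))
    (eval2_ne_zero r hr _ (RatFunc.denom_ne_zero y))

lemma sigmaHom_C (r : ℂ) (hr : r ≠ 0) (x : ℂ) : sigmaHom r hr (Cc x) = Cc x :=
  RatFunc.eval_C _ _

lemma sigmaHom_X (r : ℂ) (hr : r ≠ 0) : sigmaHom r hr Xv = Cc r * Xv :=
  RatFunc.eval_X _ _

/-- `φ_k = (az;q)_k (a/z;q)_k`. -/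
def phi (q a : ℂ) (k : ℕ) : RatFunc ℂ :=
  (∏ j ∈ Finset.range k, (1 - Cc a * Xv * Cc (q ^ j)))
      * (∏ j ∈ Finset.range k, (1 - Cc a * Xv⁻¹ * Cc (q ^ j)))

/-- Generic q-product in the function field. -/
def pp (x q : RatFunc ℂ) (k : ℕ) : RatFunc ℂ := ∏ j ∈ Finset.range k, (1 - x * q ^ j)

lemma pp_succ (x q : RatFunc ℂ) (k : ℕ) : pp x q (k+1) = pp x q k * (1 - x * q ^ k) :=
  Finset.prod_range_succ _ _

lemma pp_succ' (x q : RatFunc ℂ) (k : ℕ) : pp x q (k+1) = pp (x * q) q k * (1 - x) := by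
  unfold pp
  rw [Finset.prod_range_succ']
  congr 1
  · exact Finset.prod_congr rfl (fun j _ => by ring)
  · ring

lemma phi_eq (q a : ℂ) (k : ℕ) :
    phi q a k = pp (Cc a * Xv) (Cc q) k * pp (Cc a * Xv⁻¹) (Cc q) k := by
  unfold phi pp Cc
  simp only [map_pow]

lemma sigma_phi (r : ℂ) (hr : r ≠ 0) (q a : ℂ) (k : ℕ) :
    sigmaHom r hr (phi q a k) =
      pp (Cc a * (Cc r * Xv)) (Cc q) k * pp (Cc a * (Cc r * Xv)⁻¹) (Cc q) k := by
  rw [phi_eq, map_mul]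
  unfold pp
  simp only [map_prod, map_sub, map_one, map_mul, map_pow, map_inv₀, sigmaHom_C, sigmaHom_X]

lemma poly_ne_zero (p : Polynomial ℂ) (hp : p ≠ 0) :
    algebraMap (Polynomial ℂ) (RatFunc ℂ) p ≠ 0 := by
  intro h0
  exact hp ((map_eq_zero_iff _ (RatFunc.algebraMap_injective ℂ)).1 h0)

lemma quad_ne_zero (x y : ℂ) (hx : x ≠ 0) : Cc x - Cc y * Xv ^ 2 ≠ 0 := by
  have h := poly_ne_zero (Polynomial.C x - Polynomial.C y * Polynomial.X ^ 2) (by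
    intro h
    have := congrArg (Polynomial.eval 0) h
    simp at this
    exact hx this)
  simpa [Cc, Xv] using h

set_option maxRecDepth 20000 in
set_option maxHeartbeats 2000000 in
/-- The rational identity behind the triangularity of `D_sym`. -/
lemma core {K : Type*} [Field K] (z q a b c d Q P U V : K) (hz : z ≠ 0) (hq : q ≠ 0) (hQ : Q ≠ 0)
    (h1 : 1 - z ^ 2 ≠ 0) (h2 : 1 - q * z ^ 2 ≠ 0) (h3 : q - z ^ 2 ≠ 0)
    (hU : U * (1 - a * z) = P * (1 - a * z * Q) * (1 - a * z * (Q * q)) * (1 - a * (q * z)⁻¹))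
    (hV : V * (1 - a * z⁻¹)
      = P * (1 - a * z⁻¹ * Q) * (1 - a * z⁻¹ * (Q * q)) * (1 - a * (q⁻¹ * z))) :
    ((1 - a * z) * (1 - b * z) * (1 - c * z) * (1 - d * z)) /
      ((1 - z ^ 2) * (1 - q * z ^ 2)) * (U - P * ((1 - a * z * Q) * (1 - a * z⁻¹ * Q)))
    + ((a - z) * (b - z) * (c - z) * (d - z)) /
      ((1 - z ^ 2) * (q - z ^ 2)) * (V - P * ((1 - a * z * Q) * (1 - a * z⁻¹ * Q)))
    + (1 + q⁻¹ * a * b * c * d) * (P * ((1 - a * z * Q) * (1 - a * z⁻¹ * Q)))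
    = ((Q * q)⁻¹ + a * b * c * d * Q) * (P * ((1 - a * z * Q) * (1 - a * z⁻¹ * Q)))
      - (Q * q)⁻¹ * (1 - Q * q) * (1 - a * b * Q) * (1 - a * c * Q) * (1 - a * d * Q) * P := by
  have e1 : ((1 - a * z) * (1 - b * z) * (1 - c * z) * (1 - d * z)) /
      ((1 - z ^ 2) * (1 - q * z ^ 2)) * (U - P * ((1 - a * z * Q) * (1 - a * z⁻¹ * Q)))
      = ((1 - b * z) * (1 - c * z) * (1 - d * z)) /
      ((1 - z ^ 2) * (1 - q * z ^ 2)) *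
        (P * (1 - a * z * Q) * (1 - a * z * (Q * q)) * (1 - a * (q * z)⁻¹)
          - (1 - a * z) * (P * ((1 - a * z * Q) * (1 - a * z⁻¹ * Q)))) := by
    rw [← hU]; ring
  have e2 : ((a - z) * (b - z) * (c - z) * (d - z)) /
      ((1 - z ^ 2) * (q - z ^ 2)) * (V - P * ((1 - a * z * Q) * (1 - a * z⁻¹ * Q)))
      = (- z * (b - z) * (c - z) * (d - z)) /
      ((1 - z ^ 2) * (q - z ^ 2)) *
        (P * (1 - a * z⁻¹ * Q) * (1 - a * z⁻¹ * (Q * q)) * (1 - a * (q⁻¹ * z))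
          - (1 - a * z⁻¹) * (P * ((1 - a * z * Q) * (1 - a * z⁻¹ * Q)))) := by
    rw [← hV]
    have : a - z = - z * (1 - a * z⁻¹) := by field_simp; ring
    rw [this]; ring
  have h2b : 1 - z ^ 2 * q ≠ 0 := by rwa [mul_comm]
  rw [e1, e2]
  field_simp
  ring

lemma Cc_ne (x : ℂ) (hx : x ≠ 0) : Cc x ≠ 0 := by
  simpa [Cc] using hx

lemma Dsym_eq (q a b c d : ℂ) (hq : q ≠ 0) (f : RatFunc ℂ) : DsymOp q a b c d f =
  ((1 - Cc a * Xv) * (1 - Cc b * Xv) * (1 - Cc c * Xv) * (1 - Cc d * Xv)) /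
      ((1 - Xv ^ 2) * (1 - Cc q * Xv ^ 2)) * (sigmaHom q hq f - f)
    + ((Cc a - Xv) * (Cc b - Xv) * (Cc c - Xv) * (Cc d - Xv)) /
      ((1 - Xv ^ 2) * (Cc q - Xv ^ 2)) * (sigmaHom q⁻¹ (inv_ne_zero hq) f - f)
    + (1 + (Cc q)⁻¹ * Cc a * Cc b * Cc c * Cc d) * f := by
  have : (Cc q)⁻¹ = Cc q⁻¹ := by simp [Cc]
  unfold DsymOp
  rw [this]
  rfl

lemma Dsym_phi_zero (q a b c d : ℂ) (hq : q ≠ 0) :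
    DsymOp q a b c d (phi q a 0) = Cc (1 + q⁻¹ * (a * b * c * d)) * phi q a 0 := by
  rw [Dsym_eq q a b c d hq]
  simp [phi, Cc]
  ring

lemma Dsym_phi_succ (q a b c d : ℂ) (hq : q ≠ 0) (k : ℕ) :
    DsymOp q a b c d (phi q a (k+1))
      = Cc ((q ^ k * q)⁻¹ + a * b * c * d * q ^ k) * phi q a (k+1)
        - Cc ((q ^ k * q)⁻¹ * (1 - q ^ k * q) * (1 - a * b * q ^ k) * (1 - a * c * q ^ k)
          * (1 - a * d * q ^ k)) * phi q a k := by
  have hX : Xv ≠ 0 := RatFunc.X_ne_zero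
  have hqc := Cc_ne q hq
  have hQ : Cc q ^ k ≠ 0 := pow_ne_zero _ hqc
  have hone : Cc 1 = 1 := by simp [Cc]
  have h1 : 1 - Xv ^ 2 ≠ 0 := by simpa [hone] using quad_ne_zero 1 1 one_ne_zero
  have h2 : 1 - Cc q * Xv ^ 2 ≠ 0 := by simpa [hone] using quad_ne_zero 1 q one_ne_zero
  have h3 : Cc q - Xv ^ 2 ≠ 0 := by simpa [hone] using quad_ne_zero q 1 hq
  have hinv : Cc q⁻¹ = (Cc q)⁻¹ := by simp [Cc]
  have key : phi q a (k+1) = phi q a k *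
      ((1 - Cc a * Xv * Cc q ^ k) * (1 - Cc a * Xv⁻¹ * Cc q ^ k)) := by
    rw [phi_eq, phi_eq, pp_succ, pp_succ]; ring
  have hU : sigmaHom q hq (phi q a (k+1)) * (1 - Cc a * Xv) = phi q a k *
      (1 - Cc a * Xv * Cc q ^ k) * (1 - Cc a * Xv * (Cc q ^ k * Cc q))
        * (1 - Cc a * (Cc q * Xv)⁻¹) := by
    rw [sigma_phi, phi_eq, pp_succ' (Cc a * (Cc q * Xv)⁻¹)]
    have e1 : Cc a * (Cc q * Xv)⁻¹ * Cc q = Cc a * Xv⁻¹ := by field_simp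
    have e2 : pp (Cc a * (Cc q * Xv)) (Cc q) (k+1) * (1 - Cc a * Xv)
        = pp (Cc a * Xv) (Cc q) k * (1 - Cc a * Xv * Cc q ^ k)
          * (1 - Cc a * Xv * (Cc q ^ k * Cc q)) := by
      have := pp_succ' (Cc a * Xv) (Cc q) (k+1)
      rw [pp_succ (Cc a * Xv), pp_succ (Cc a * Xv), pow_succ] at this
      rw [this]; congr 2; ring
    rw [e1]
    linear_combination (pp (Cc a * Xv⁻¹) (Cc q) k * (1 - Cc a * (Cc q * Xv)⁻¹)) * e2
  have hV : sigmaHom q⁻¹ (inv_ne_zero hq) (phi q a (k+1)) * (1 - Cc a * Xv⁻¹) = phi q a k *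
      (1 - Cc a * Xv⁻¹ * Cc q ^ k) * (1 - Cc a * Xv⁻¹ * (Cc q ^ k * Cc q))
        * (1 - Cc a * ((Cc q)⁻¹ * Xv)) := by
    rw [sigma_phi, phi_eq, hinv, pp_succ' (Cc a * ((Cc q)⁻¹ * Xv))]
    have e1 : Cc a * ((Cc q)⁻¹ * Xv) * Cc q = Cc a * Xv := by field_simp
    have e2 : pp (Cc a * ((Cc q)⁻¹ * Xv)⁻¹) (Cc q) (k+1) * (1 - Cc a * Xv⁻¹)
        = pp (Cc a * Xv⁻¹) (Cc q) k * (1 - Cc a * Xv⁻¹ * Cc q ^ k)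
          * (1 - Cc a * Xv⁻¹ * (Cc q ^ k * Cc q)) := by
      have := pp_succ' (Cc a * Xv⁻¹) (Cc q) (k+1)
      rw [pp_succ (Cc a * Xv⁻¹), pp_succ (Cc a * Xv⁻¹), pow_succ] at this
      rw [this]; congr 2; rw [mul_inv, inv_inv]; ring
    rw [e1]
    linear_combination (pp (Cc a * Xv) (Cc q) k * (1 - Cc a * ((Cc q)⁻¹ * Xv))) * e2
  have hc := core Xv (Cc q) (Cc a) (Cc b) (Cc c) (Cc d) (Cc q ^ k) (phi q a k) _ _
    hX hqc hQ h1 h2 h3 hU hV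
  rw [← key] at hc
  rw [Dsym_eq q a b c d hq, hc]
  simp [Cc]

lemma Dsym_sum (q a b c d : ℂ) (hq : q ≠ 0) (n : ℕ) (s : ℕ → ℂ) (g : ℕ → RatFunc ℂ) :
    DsymOp q a b c d (∑ k ∈ Finset.range n, Cc (s k) * g k)
      = ∑ k ∈ Finset.range n, Cc (s k) * DsymOp q a b c d (g k) := by
  simp only [Dsym_eq q a b c d hq]
  induction n with
  | zero => simp
  | succ n ih =>
    rw [Finset.sum_range_succ, Finset.sum_range_succ, ← ih]
    simp only [map_add, map_mul, sigmaHom_C]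
    ring

lemma Dsym_smul (q a b c d : ℂ) (hq : q ≠ 0) (s : ℂ) (g : RatFunc ℂ) :
    DsymOp q a b c d (Cc s * g) = Cc s * DsymOp q a b c d g := by
  simp only [Dsym_eq q a b c d hq, map_mul, sigmaHom_C]
  ring

lemma qPoch_succ (x q : ℂ) (k : ℕ) : qPoch x q (k+1) = qPoch x q k * (1 - x * q ^ k) :=
  Finset.prod_range_succ _ _

lemma qPoch_succ' (x q : ℂ) (k : ℕ) : qPoch x q (k+1) = (1 - x) * qPoch (x * q) q k := by
  unfold qPoch
  rw [Finset.prod_range_succ', mul_comm]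
  congr 1
  · ring
  · exact Finset.prod_congr rfl (fun j _ => by ring)

/-- Coefficients of the expansion of `P_n`. -/
def cf (q a b c d : ℂ) (n k : ℕ) : ℂ :=
  qPoch (q⁻¹ ^ n) q k * qPoch (a * b * q ^ k) q (n - k) * qPoch (a * c * q ^ k) q (n - k)
        * qPoch (a * d * q ^ k) q (n - k) * q ^ k
        / (qPoch q q k * qPoch (a * b * c * d * q ^ (n + k) / q) q (n - k))

lemma cf_rec (q a b c d : ℂ) (hq : q ≠ 0) (hroot : ∀ m : ℕ, 1 ≤ m → q ^ m ≠ 1)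
    (habcd : ∀ m : ℕ, a * b * c * d ≠ q⁻¹ ^ m) (n k : ℕ) (hk : k < n) :
    cf q a b c d n (k+1) * ((q ^ k * q)⁻¹ * (1 - q ^ k * q) * (1 - a * b * q ^ k)
        * (1 - a * c * q ^ k) * (1 - a * d * q ^ k))
      = cf q a b c d n k * (((q ^ k)⁻¹ + a * b * c * d * (q ^ k / q))
          - ((q ^ n)⁻¹ + a * b * c * d * (q ^ n / q))) := by
  obtain ⟨m, rfl⟩ : ∃ m, n = k + 1 + m := ⟨n - (k+1), by omega⟩
  unfold cf
  have s1 : k + 1 + m - (k + 1) = m := by omega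
  have s2 : k + 1 + m - k = m + 1 := by omega
  rw [s1, s2, qPoch_succ _ q k, qPoch_succ q q k, qPoch_succ' (a * b * q ^ k),
    qPoch_succ' (a * c * q ^ k), qPoch_succ' (a * d * q ^ k),
    qPoch_succ' (a * b * c * d * q ^ (k + 1 + m + k) / q)]
  have t1 : ∀ x : ℂ, x * q ^ k * q = x * q ^ (k + 1) := fun x => by ring
  have t2 : a * b * c * d * q ^ (k + 1 + m + k) / q * q
      = a * b * c * d * q ^ (k + 1 + m + (k + 1)) / q := by field_simp; ring
  rw [t1 (a * b), t1 (a * c), t1 (a * d), t2]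
  have hA : ∀ j : ℕ, 1 - a * b * c * d * q ^ j ≠ 0 := by
    intro j h
    apply habcd j
    rw [inv_pow]
    field_simp
    linear_combination -h
  have hD : qPoch (a * b * c * d * q ^ (k + 1 + m + (k + 1)) / q) q m ≠ 0 := by
    unfold qPoch
    refine Finset.prod_ne_zero_iff.2 (fun j _ => ?_)
    convert hA (k + 1 + m + k + j) using 2
    field_simp
    ring
  have hE : qPoch q q k ≠ 0 := by
    unfold qPoch
    refine Finset.prod_ne_zero_iff.2 (fun j _ h => hroot (j+1) (by omega) ?_)
    linear_combination -h
  have hG : 1 - q * q ^ k ≠ 0 := fun h => hroot (k+1) (by omega) (by linear_combination -h)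
  have hH : 1 - a * b * c * d * q ^ (k + 1 + m + k) / q ≠ 0 := by
    convert hA (k + m + k) using 2
    field_simp
    ring
  have hn : (q ^ k)⁻¹ + a * b * c * d * (q ^ k / q)
          - ((q ^ (k + 1 + m))⁻¹ + a * b * c * d * (q ^ (k + 1 + m) / q))
      = (q ^ k)⁻¹ * (1 - q⁻¹ ^ (k + 1 + m) * q ^ k)
        * (1 - a * b * c * d * q ^ (k + 1 + m + k) / q) := by
    rw [inv_pow]
    field_simp
    ring
  rw [hn]
  generalize qPoch (a * b * c * d * q ^ (k + 1 + m + (k + 1)) / q) q m = W at *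
  generalize 1 - a * b * c * d * q ^ (k + 1 + m + k) / q = W2 at *
  generalize 1 - q⁻¹ ^ (k + 1 + m) * q ^ k = W3 at *
  generalize qPoch q q k = W4 at *
  generalize qPoch (a * b * q ^ (k + 1)) q m = V1
  generalize qPoch (a * c * q ^ (k + 1)) q m = V2
  generalize qPoch (a * d * q ^ (k + 1)) q m = V3
  generalize qPoch (q⁻¹ ^ (k + 1 + m)) q k = V4
  have hG' : 1 - q ^ k * q ≠ 0 := by rwa [mul_comm]
  rw [mul_comm q (q ^ k), pow_succ]
  have hQ : q ^ k ≠ 0 := pow_ne_zero _ hq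
  clear hA hn hG t1 t2 habcd hroot
  generalize q ^ k = Q at *
  field_simp

lemma AWP_eq (q a b c d : ℂ) (n : ℕ) : AWP q a b c d n =
    Cc (a⁻¹ ^ n) * ∑ k ∈ Finset.range (n + 1), Cc (cf q a b c d n k) * phi q a k := by
  unfold AWP cf phi
  simp only [mul_assoc]

lemma Cc_sub (x y : ℂ) : Cc (x - y) = Cc x - Cc y := by simp [Cc]
lemma Cc_mul (x y : ℂ) : Cc (x * y) = Cc x * Cc y := by simp [Cc]

/-- Partial sums: applying `D_sym - λ_n` telescopes. -/
lemma partial_sum (q a b c d : ℂ) (hq : q ≠ 0) (hroot : ∀ m : ℕ, 1 ≤ m → q ^ m ≠ 1)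
    (habcd : ∀ m : ℕ, a * b * c * d ≠ q⁻¹ ^ m) (n m : ℕ) (hm : m ≤ n) :
    ∑ k ∈ Finset.range (m + 1), Cc (cf q a b c d n k) * DsymOp q a b c d (phi q a k)
      = Cc ((q ^ n)⁻¹ + a * b * c * d * (q ^ n / q)) *
          ∑ k ∈ Finset.range (m + 1), Cc (cf q a b c d n k) * phi q a k
        + Cc (cf q a b c d n m * (((q ^ m)⁻¹ + a * b * c * d * (q ^ m / q))
          - ((q ^ n)⁻¹ + a * b * c * d * (q ^ n / q)))) * phi q a m := by
  induction m with
  | zero =>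
    simp only [zero_add, Finset.sum_range_one, Dsym_phi_zero q a b c d hq, pow_zero, inv_one]
    rw [show 1 + q⁻¹ * (a * b * c * d) = 1 + a * b * c * d * (1 / q) by ring]
    simp only [Cc_mul (cf q a b c d n 0), Cc_sub]
    ring
  | succ m ih =>
    rw [Finset.sum_range_succ, Finset.sum_range_succ _ (m + 1), ih (by omega),
      Dsym_phi_succ q a b c d hq, ← cf_rec q a b c d hq hroot habcd n m (by omega)]
    have : q ^ (m + 1) / q = q ^ m := by rw [pow_succ]; field_simp
    rw [this, pow_succ]
    simp only [Cc_mul (cf q a b c d n _), Cc_sub ((q ^ m * q)⁻¹ + a * b * c * d * q ^ m)]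
    ring

theorem stmt14 (q a b c d : ℂ) (hq : q ≠ 0) (hroot : ∀ m : ℕ, 1 ≤ m → q ^ m ≠ 1)
    (ha : a ≠ 0) (hb : b ≠ 0) (hc : c ≠ 0) (hd : d ≠ 0)
    (habcd : ∀ m : ℕ, a * b * c * d ≠ q⁻¹ ^ m) :
    ∀ n : ℕ,
      DsymOp q a b c d (AWP q a b c d n)
        = Cc (q ^ (-(n : ℤ)) + a * b * c * d * q ^ ((n : ℤ) - 1)) * AWP q a b c d n := by
  intro n
  have h := partial_sum q a b c d hq hroot habcd n n le_rfl
  rw [sub_self, mul_zero] at h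
  have h0 : Cc 0 = 0 := by simp [Cc]
  rw [h0, zero_mul, add_zero] at h
  have hl : q ^ (-(n : ℤ)) + a * b * c * d * q ^ ((n : ℤ) - 1)
      = (q ^ n)⁻¹ + a * b * c * d * (q ^ n / q) := by
    rw [zpow_neg, zpow_sub₀ hq, zpow_natCast, zpow_one]
  rw [hl, AWP_eq, Dsym_smul q a b c d hq, Dsym_sum q a b c d hq, h]
  ring

end
end

section
/- In the basic representation of the double affine Hecke algebra of type (C_1^∨, C_1), the operators satisfy Y Z = qZY + (1+ab)cd·Z^{-1}Y^{-1}T_1 − (a+b)cd·Y^{-1}T_1 − (1+q^{-1}cd)Z^{-1}T_1 − (1−q)(1+ab)(1+q^{-1}cd)Z^{-1} + (c+d)T_1 + (1−q)(a+b)(1+q^{-1}cd), as operators on Laurent polynomials. -/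
open scoped BigOperators

noncomputable section

/-- The field of rational functions over ℂ, in which Laurent polynomials live. -/
local notation "F" => RatFunc ℂ

lemma trans_ne (t : F) (ht : Transcendental ℂ t) (p : Polynomial ℂ) (hp : p ≠ 0) :
    p.eval₂ (RatFunc.C) t ≠ 0 := by
  intro h
  apply ht
  exact ⟨p, hp, by rw [Polynomial.aeval_def]; exact h⟩

lemma subst_add (t : F) (ht : Transcendental ℂ t) (f g : F) :
    subst t (f + g) = subst t f + subst t g :=
  RatFunc.eval_add _ _ (trans_ne t ht _ (RatFunc.denom_ne_zero f))
    (trans_ne t ht _ (RatFunc.denom_ne_zero g))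

lemma subst_mul (t : F) (ht : Transcendental ℂ t) (f g : F) :
    subst t (f * g) = subst t f * subst t g :=
  RatFunc.eval_mul _ _ (trans_ne t ht _ (RatFunc.denom_ne_zero f))
    (trans_ne t ht _ (RatFunc.denom_ne_zero g))

/-- Substitution of a transcendental element as a ring homomorphism. -/
def substHom (t : F) (ht : Transcendental ℂ t) : F →+* F where
  toFun := subst t
  map_one' := by simp [subst]
  map_zero' := by simp [subst]
  map_add' := subst_add t ht
  map_mul' := subst_mul t ht

lemma trans_X : Transcendental ℂ (Xv : F) := by
  intro ⟨p, hp, h⟩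
  apply hp
  have : Polynomial.aeval (RatFunc.X : RatFunc ℂ) p = algebraMap _ _ p := by
    rw [← RatFunc.algebraMap_X, Polynomial.aeval_algebraMap_apply, Polynomial.aeval_X_left_apply]
  rw [Xv, this] at h
  exact (map_eq_zero_iff _ (RatFunc.algebraMap_injective ℂ)).1 h

lemma Xv_ne : (Xv : F) ≠ 0 := RatFunc.X_ne_zero

lemma trans_inv : Transcendental ℂ (Xv⁻¹ : F) := by
  intro h
  apply trans_X
  simpa using h.inv

lemma trans_q (q : ℂ) (hq : q ≠ 0) : Transcendental ℂ (Cc q * Xv⁻¹ : F) := by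
  intro h
  apply trans_X
  have hc : Cc q ≠ 0 := by simpa [Cc] using hq
  have h2 : IsAlgebraic ℂ (Cc q) := isAlgebraic_algebraMap q
  have h3 := h2.mul h.inv
  have e : Cc q * (Cc q * Xv⁻¹)⁻¹ = Xv := by field_simp
  rwa [e] at h3

lemma sq_ne (q : ℂ) : Cc q - Xv ^ 2 ≠ 0 := by
  have h := trans_ne Xv trans_X (Polynomial.C q - Polynomial.X ^ 2) (by
    intro h
    have := congrArg (fun p => Polynomial.coeff p 2) h
    simp at this)
  simpa [Cc] using h

lemma sq_ne' (q : ℂ) : Cc q * Xv ^ 2 - 1 ≠ 0 := by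
  have h := trans_ne Xv trans_X (Polynomial.C q * Polynomial.X ^ 2 - 1) (by
    intro h
    have := congrArg (fun p => Polynomial.coeff p 0) h
    simp at this)
  simpa [Cc] using h

lemma hom_C (t : F) (ht : Transcendental ℂ t) (x : ℂ) : substHom t ht (Cc x) = Cc x := by
  simp [substHom, subst, Cc]

lemma hom_X (t : F) (ht : Transcendental ℂ t) : substHom t ht Xv = t := by
  simp [substHom, subst, Xv]

lemma hom_alg (t : F) (ht : Transcendental ℂ t) (p : Polynomial ℂ) :
    substHom t ht (algebraMap _ _ p) = p.eval₂ RatFunc.C t := by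
  simp [substHom, subst]

lemma hom_invol (f : F) (hf : IsLaurent f) :
    substHom Xv⁻¹ trans_inv (substHom Xv⁻¹ trans_inv f) = f := by
  obtain ⟨p, n, rfl⟩ := hf
  have hc : (substHom Xv⁻¹ trans_inv).comp RatFunc.C = RatFunc.C := by
    ext x
    exact hom_C _ trans_inv x
  have hX : Polynomial.eval₂ RatFunc.C Xv p = algebraMap _ F p := by
    have : Polynomial.aeval (RatFunc.X : RatFunc ℂ) p = algebraMap _ _ p := by
      rw [← RatFunc.algebraMap_X, Polynomial.aeval_algebraMap_apply,
        Polynomial.aeval_X_left_apply]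
    exact this
  simp only [map_div₀, map_pow, hom_X, hom_alg, map_inv₀, inv_inv, Polynomial.hom_eval₂, hc, hX]

theorem stmt19 (q a b c d : ℂ) (hq : q ≠ 0) (hroot : ∀ m : ℕ, 1 ≤ m → q ^ m ≠ 1)
    (ha : a ≠ 0) (hb : b ≠ 0) (hc : c ≠ 0) (hd : d ≠ 0) :
    ∀ f : RatFunc ℂ, IsLaurent f →
      Yop q a b c d (Xv * f)
        = Cc q * (Xv * Yop q a b c d f)
          + Cc ((1 + a * b) * (c * d)) * (Xv⁻¹ * Yinv q a b c d (T1op a b f))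
          - Cc ((a + b) * (c * d)) * Yinv q a b c d (T1op a b f)
          - Cc (1 + q⁻¹ * (c * d)) * (Xv⁻¹ * T1op a b f)
          - Cc ((1 - q) * (1 + a * b) * (1 + q⁻¹ * (c * d))) * (Xv⁻¹ * f)
          + Cc (c + d) * T1op a b f
          + Cc ((1 - q) * (a + b) * (1 + q⁻¹ * (c * d))) * f := by
  intro f hf
  have e1 : ∀ g, subst Xv⁻¹ g = substHom Xv⁻¹ trans_inv g := fun _ => rfl
  have e0 : ∀ g, subst (Cc q * Xv⁻¹) g = substHom (Cc q * Xv⁻¹) (trans_q q hq) g := fun _ => rfl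
  have hinv := hom_invol f hf
  have cne : ∀ x : ℂ, x ≠ 0 → Cc x ≠ 0 := fun x hx => by simpa [Cc] using hx
  have Cadd : ∀ x y, Cc (x + y) = Cc x + Cc y := fun x y => map_add _ x y
  have Csub : ∀ x y, Cc (x - y) = Cc x - Cc y := fun x y => map_sub _ x y
  have Cmul : ∀ x y, Cc (x * y) = Cc x * Cc y := fun x y => map_mul _ x y
  have Cinv : ∀ x, Cc (x⁻¹) = (Cc x)⁻¹ := fun x => map_inv₀ _ x
  have C1 : Cc 1 = 1 := map_one _
  have hz := Xv_ne
  have hq' := cne q hq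
  have ha' := cne a ha
  have hb' := cne b hb
  have hc' := cne c hc
  have hd' := cne d hd
  have n1 : (1 : F) - Xv ^ 2 ≠ 0 := by simpa [C1] using sq_ne 1
  have n1' : Xv ^ 2 - (1 : F) ≠ 0 := by simpa [C1] using sq_ne' 1
  have nq := sq_ne q
  have nq' := sq_ne' q
  have hT : T1inv a b (T1op a b f) = f := by
    simp only [T1inv, T1op, e1, map_add, map_mul, map_sub, map_div₀, map_pow, map_one, map_inv₀,
      hom_C, hom_X, hinv]
    generalize substHom Xv⁻¹ trans_inv f = f1
    clear e1 e0 hinv hf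
    generalize Cc a = a at *
    generalize Cc b = b at *
    generalize Xv = z at *
    have i1 : 1 - z⁻¹ ^ 2 = (z ^ 2 - 1) / z ^ 2 := by field_simp
    have i2 : z ^ 2 - 1 = - (1 - z ^ 2) := by ring
    rw [i1, i2]
    field_simp
    ring
  simp only [Yinv, hT]
  simp only [Yop, T0inv, T0op, T1op, e1, e0, map_add, map_mul, map_sub, map_div₀, map_pow, map_one,
    map_inv₀, hom_C, hom_X, Cadd, Csub, Cmul, Cinv, C1]
  generalize substHom Xv⁻¹ trans_inv (substHom (Cc q * Xv⁻¹) (trans_q q hq) f) = f10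
  generalize substHom (Cc q * Xv⁻¹) (trans_q q hq) f = f0
  generalize substHom Xv⁻¹ trans_inv f = f1
  clear e1 e0 hinv hT hf hroot cne
  generalize Cc a = a at *
  generalize Cc b = b at *
  generalize Cc c = c at *
  generalize Cc d = d at *
  generalize Cc q = q at *
  generalize Xv = z at *
  have i1 : q - z⁻¹ ^ 2 = (q * z ^ 2 - 1) / z ^ 2 := by field_simp
  have nq2 : z ^ 2 * q - 1 ≠ 0 := by rwa [mul_comm]
  rw [i1]
  field_simp
  ring


end
end
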